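/- arXiv:2011.00354 — 4 statements merged into one kernel-verified Lean document; each statement's English description precedes it below -/
import Mathlib

section
/- Let 1 < p ≤ 2 and f_p(x) := |x|^p. For all real r, s with r ≠ 0, s ≠ 0 and r ≠ s, one has f_p^{[2]}(r, s, r) + f_p^{[2]}(s, r, s) ≥ f_p^{[2]}(|r|, |s|, |r|) + f_p^{[2]}(|s|, |r|, |s|), where when |r| = |s| the right-hand side is interpreted as 2·f_p^{[2]}(|r|,|r|,|r|) = p(p−1)|r|^{p−2}. -/
/-- First divided difference: `f^{[1]}(r,s) = (f r - f s)/(r - s)` for `r ≠ s`,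
and `f'(r)` for `r = s`. -/
noncomputable def dd1 (f : ℝ → ℝ) (r s : ℝ) : ℝ :=
  if r = s then deriv f r else (f r - f s) / (r - s)

/-- Second divided difference: `f^{[2]}(r,s,t) = (f^{[1]}(r,s) - f^{[1]}(r,t))/(s - t)`
for `s ≠ t`, and `(∂/∂λ)|_{λ=s} f^{[1]}(r,λ)` for `s = t`. -/
noncomputable def dd2 (f : ℝ → ℝ) (r s t : ℝ) : ℝ :=
  if s = t then deriv (fun x => dd1 f r x) s else (dd1 f r s - dd1 f r t) / (s - t)

lemma dd1_comm (f : ℝ → ℝ) (r s : ℝ) : dd1 f r s = dd1 f s r := by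
  unfold dd1
  rcases eq_or_ne r s with rfl | h
  · rfl
  · rw [if_neg h, if_neg h.symm, ← neg_sub (f s), ← neg_sub s, neg_div_neg_eq]

lemma dd2_add_dd2_of_ne (f : ℝ → ℝ) {r s : ℝ} (h : r ≠ s) :
    dd2 f r s r + dd2 f s r s = (deriv f r - deriv f s) / (r - s) := by
  have h1 : r - s ≠ 0 := sub_ne_zero.2 h
  have h2 : s - r ≠ 0 := sub_ne_zero.2 h.symm
  have hr : dd1 f r r = deriv f r := if_pos rfl
  have hs : dd1 f s s = deriv f s := if_pos rfl
  rw [dd2, dd2, if_neg h.symm, if_neg h, dd1_comm f s r, hr, hs, ← neg_sub r s, div_neg]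
  field_simp
  ring

lemma deriv_abs_rpow_of_pos (p : ℝ) {a : ℝ} (ha : 0 < a) :
    deriv (fun x : ℝ => |x| ^ p) a = p * a ^ (p - 1) := by
  have h : (fun x : ℝ => |x| ^ p) =ᶠ[nhds a] fun x => x ^ p := by
    filter_upwards [lt_mem_nhds ha] with x hx
    rw [abs_of_pos hx]
  rw [h.deriv_eq, Real.deriv_rpow_const]

lemma deriv_abs_rpow_neg (p a : ℝ) :
    deriv (fun x : ℝ => |x| ^ p) (-a) = -deriv (fun x : ℝ => |x| ^ p) a := by
  have h := deriv_comp_neg (fun x : ℝ => |x| ^ p) a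
  simp only [abs_neg] at h
  rw [h, neg_neg]

lemma rpow_one_add_le_quadratic {p u : ℝ} (hp1 : 1 < p) (hp2 : p ≤ 2) (hu : 0 ≤ u) :
    (1 + u) ^ p ≤ 1 + p * u + p / 2 * u ^ 2 := by
  have h := rpow_one_add_le_one_add_mul_self (s := u) (by linarith) (p := p - 1)
    (by linarith) (by linarith)
  have e : (1 + u) ^ p = (1 + u) ^ (p - 1) * (1 + u) := by
    rw [← Real.rpow_add_one (by positivity), sub_add_cancel]
  rw [e]
  nlinarith [mul_le_mul_of_nonneg_right h (by linarith : 0 ≤ 1 + u),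
    mul_nonneg (sub_nonneg.2 hp2) (sq_nonneg u)]

lemma rpow_le_quadratic {p a x : ℝ} (hp1 : 1 < p) (hp2 : p ≤ 2) (ha : 0 < a) (hx : a ≤ x) :
    x ^ p ≤ a ^ p + p * a ^ (p - 1) * (x - a) + p / 2 * a ^ (p - 2) * (x - a) ^ 2 := by
  have hu : 0 ≤ (x - a) / a := div_nonneg (sub_nonneg.2 hx) ha.le
  have h := mul_le_mul_of_nonneg_left (rpow_one_add_le_quadratic hp1 hp2 hu)
    (Real.rpow_nonneg ha.le p)
  have e : a * (1 + (x - a) / a) = x := by field_simp; ring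
  rw [← Real.mul_rpow ha.le (by positivity), e] at h
  refine h.trans_eq ?_
  rw [Real.rpow_sub_one ha.ne', Real.rpow_sub ha p 2, Real.rpow_two]
  field_simp

lemma dd2_abs_rpow_diag_le {p a : ℝ} (hp1 : 1 < p) (hp2 : p ≤ 2) (ha : 0 < a) :
    dd2 (fun x => |x| ^ p) a a a ≤ p / 2 * a ^ (p - 2) := by
  rw [dd2, if_pos rfl]
  by_cases hd : DifferentiableAt ℝ (fun x => dd1 (fun x => |x| ^ p) a x) a
  · have ht := (hasDerivAt_iff_tendsto_slope.1 hd.hasDerivAt).mono_left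
      (nhdsWithin_mono a fun x (hx : x ∈ Set.Ioi a) => ne_of_gt hx)
    refine le_of_tendsto ht ?_
    filter_upwards [self_mem_nhdsWithin] with x hx
    have hx : a < x := hx
    have h0 : 0 < x - a := sub_pos.2 hx
    have h := rpow_le_quadratic hp1 hp2 ha hx.le
    rw [slope_def_field, dd1_comm, dd1, dd1, if_neg hx.ne', if_pos rfl,
      deriv_abs_rpow_of_pos p ha, abs_of_pos ha, abs_of_pos (ha.trans hx),
      div_le_iff₀ h0, sub_le_iff_le_add, div_le_iff₀ h0]
    linarith
  · rw [deriv_zero_of_not_differentiableAt hd]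
    have := Real.rpow_nonneg ha.le (p - 2)
    have : 0 ≤ p / 2 := by linarith
    positivity

lemma rpow_mul_le_mul_rpow {q a b : ℝ} (hq : q ≤ 1) (hb : 0 < b) (hab : b ≤ a) :
    a ^ q * b ≤ a * b ^ q := by
  have ha : 0 < a := hb.trans_le hab
  have h := Real.rpow_le_rpow_of_nonpos hb hab (sub_nonpos.2 hq)
  rw [Real.rpow_sub_one ha.ne', Real.rpow_sub_one hb.ne', div_le_div_iff₀ ha hb] at h
  linarith

lemma rpow_slope_le {q a b : ℝ} (hq : q ≤ 1) (hb : 0 < b) (hab : b < a) :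
    (a ^ q - b ^ q) / (a - b) ≤ (a ^ q + b ^ q) / (a + b) := by
  rw [div_le_div_iff₀ (sub_pos.2 hab) (by linarith)]
  linarith [rpow_mul_le_mul_rpow hq hb hab.le]

lemma dd2_abs_rpow_add_le {p a b : ℝ} (hp1 : 1 < p) (hp2 : p ≤ 2) (ha : 0 < a) (hb : 0 < b) :
    dd2 (fun x => |x| ^ p) a b a + dd2 (fun x => |x| ^ p) b a b ≤
      p * ((a ^ (p - 1) + b ^ (p - 1)) / (a + b)) := by
  have hq : p - 1 ≤ 1 := by linarith
  have hp : 0 ≤ p := by linarith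
  rcases eq_or_ne a b with rfl | h
  · have h := dd2_abs_rpow_diag_le hp1 hp2 ha
    have e : a ^ (p - 2) = (a ^ (p - 1) + a ^ (p - 1)) / (a + a) := by
      rw [show p - 2 = p - 1 - 1 by ring, Real.rpow_sub_one ha.ne' (p - 1)]
      field_simp
    rw [← e]
    linarith
  · rw [dd2_add_dd2_of_ne _ h, deriv_abs_rpow_of_pos p ha, deriv_abs_rpow_of_pos p hb,
      ← mul_sub, mul_div_assoc]
    refine mul_le_mul_of_nonneg_left ?_ hp
    rcases h.lt_or_gt with h | h
    · rw [← neg_sub (b ^ _), ← neg_sub b, neg_div_neg_eq, add_comm (a ^ _), add_comm a]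
      exact rpow_slope_le hq ha h
    · exact rpow_slope_le hq hb h

/-- For `1 < p ≤ 2`, `f_p(x) = |x|^p` and nonzero `r ≠ s`:
`f_p^{[2]}(r,s,r) + f_p^{[2]}(s,r,s) ≥ f_p^{[2]}(|r|,|s|,|r|) + f_p^{[2]}(|s|,|r|,|s|)`.
(When `|r| = |s|` the right-hand side is the diagonal divided difference, whose value is
`p(p−1)|r|^{p−2}`.) -/
theorem dd2_abs_rpow_sum_ge (p : ℝ) (hp1 : 1 < p) (hp2 : p ≤ 2) (r s : ℝ)
    (hr : r ≠ 0) (hs : s ≠ 0) (hrs : r ≠ s) :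
    dd2 (fun x => |x| ^ p) (|r|) (|s|) (|r|) + dd2 (fun x => |x| ^ p) (|s|) (|r|) (|s|) ≤
      dd2 (fun x => |x| ^ p) r s r + dd2 (fun x => |x| ^ p) s r s := by
  rcases hr.lt_or_gt with hr | hr <;> rcases hs.lt_or_gt with hs | hs
  · have h : -r ≠ -s := neg_injective.ne hrs
    rw [abs_of_neg hr, abs_of_neg hs, dd2_add_dd2_of_ne _ hrs, dd2_add_dd2_of_ne _ h,
      deriv_abs_rpow_neg, deriv_abs_rpow_neg, ← neg_sub', ← neg_sub', neg_div_neg_eq]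
  · refine (dd2_abs_rpow_add_le hp1 hp2 (abs_pos.2 hr.ne) (abs_pos.2 hs.ne')).trans_eq ?_
    have hd := deriv_abs_rpow_neg p (-r)
    rw [neg_neg, deriv_abs_rpow_of_pos p (neg_pos.2 hr)] at hd
    rw [dd2_add_dd2_of_ne _ hrs, hd, deriv_abs_rpow_of_pos p hs, abs_of_neg hr, abs_of_pos hs,
      ← mul_div_assoc, ← neg_div_neg_eq]
    congr 1 <;> ring
  · refine (dd2_abs_rpow_add_le hp1 hp2 (abs_pos.2 hr.ne') (abs_pos.2 hs.ne)).trans_eq ?_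
    have hd := deriv_abs_rpow_neg p (-s)
    rw [neg_neg, deriv_abs_rpow_of_pos p (neg_pos.2 hs)] at hd
    rw [dd2_add_dd2_of_ne _ hrs, hd, deriv_abs_rpow_of_pos p hr, abs_of_pos hr, abs_of_neg hs,
      ← mul_div_assoc]
    congr 1
    ring
  · rw [abs_of_pos hr, abs_of_pos hs]
end

section
/- Let 1 < p ≤ 2. For all positive reals r ≠ s, one has (r^{p−1} − s^{p−1})/(r − s) ≤ (r^{p−1} + s^{p−1})/(r + s). -/
theorem rpow_divided_difference_le_of_lt {a r s : ℝ} (ha : a ≤ 1) (hs : 0 < s) (hsr : s < r) :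
    (r ^ a - s ^ a) / (r - s) ≤ (r ^ a + s ^ a) / (r + s) := by
  have hr : 0 < r := hs.trans hsr
  have hmono : r ^ (a - 1) ≤ s ^ (a - 1) :=
    Real.rpow_le_rpow_of_nonpos hs hsr.le (by linarith)
  rw [Real.rpow_sub_one hr.ne', Real.rpow_sub_one hs.ne', div_le_div_iff₀ hr hs] at hmono
  rw [div_le_div_iff₀ (sub_pos.mpr hsr) (add_pos hr hs)]
  linarith

/-- For `1 < p ≤ 2` and distinct positive reals `r, s`:
`(r^{p−1} − s^{p−1})/(r − s) ≤ (r^{p−1} + s^{p−1})/(r + s)`. -/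
theorem rpow_divided_difference_le (p : ℝ) (hp1 : 1 < p) (hp2 : p ≤ 2)
    (r s : ℝ) (hr : 0 < r) (hs : 0 < s) (hrs : r ≠ s) :
    (r ^ (p - 1) - s ^ (p - 1)) / (r - s) ≤ (r ^ (p - 1) + s ^ (p - 1)) / (r + s) := by
  have hp : p - 1 ≤ 1 := by linarith
  rcases hrs.lt_or_gt with h | h
  · rw [← neg_sub (s ^ (p - 1)), ← neg_sub s r, neg_div_neg_eq, add_comm (r ^ (p - 1)),
      add_comm r]
    exact rpow_divided_difference_le_of_lt hp hr h
  · exact rpow_divided_difference_le_of_lt hp hs h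
end

section
/- Let 0 < α < 1 and define g_α : (0, ∞) → (0, ∞) by g_α(x) := ((x^α − 1)/(x − 1))^{1/(α−1)} for x ≠ 1 and g_α(1) := α^{1/(α−1)}. Then g_α is operator monotone: for every n and all positive definite n × n Hermitian matrices A, B with A ≤ B in the Loewner order, one has g_α(A) ≤ g_α(B), where g_α is applied via the functional calculus. -/
open scoped ComplexOrder

/-- Application of a real function `f` to a Hermitian matrix via the functional calculus:
`f(A) = U · diag(f(λ_i)) · U*` where `A = U · diag(λ_i) · U*` is a spectral decomposition. -/
noncomputable def hermApply (f : ℝ → ℝ) {k : ℕ} {A : Matrix (Fin k) (Fin k) ℂ}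
    (hA : A.IsHermitian) : Matrix (Fin k) (Fin k) ℂ :=
  (hA.eigenvectorUnitary : Matrix (Fin k) (Fin k) ℂ) *
    Matrix.diagonal (fun i => (f (hA.eigenvalues i) : ℂ)) *
    (star (hA.eigenvectorUnitary : Matrix (Fin k) (Fin k) ℂ))

/-- `g_α(x) = ((x^α − 1)/(x − 1))^{1/(α−1)}` for `x ≠ 1`, and `g_α(1) = α^{1/(α−1)}`. -/
noncomputable def gAlpha (α : ℝ) (x : ℝ) : ℝ :=
  if x = 1 then α ^ (1 / (α - 1)) else ((x ^ α - 1) / (x - 1)) ^ (1 / (α - 1))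

open MeasureTheory Set Filter Topology Matrix

/-- A real function is operator monotone on `(0, ∞)` if `hermApply` preserves the Loewner order
on positive definite matrices of every size. -/
def IsOperatorMonotone (f : ℝ → ℝ) : Prop :=
  ∀ (k : ℕ) (A B : Matrix (Fin k) (Fin k) ℂ) (hA : A.PosDef) (hB : B.PosDef),
    (B - A).PosSemidef → (hermApply f hB.1 - hermApply f hA.1).PosSemidef

section HermApply

variable {k : ℕ} {A : Matrix (Fin k) (Fin k) ℂ}

lemma isHermitian_hermApply (f : ℝ → ℝ) (hA : A.IsHermitian) : (hermApply f hA).IsHermitian := by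
  unfold hermApply
  rw [star_eq_conjTranspose]
  refine isHermitian_mul_mul_conjTranspose _ (isHermitian_diagonal_of_self_adjoint _ ?_)
  ext i
  simp

lemma hermApply_id (hA : A.IsHermitian) : hermApply (fun x => x) hA = A :=
  (hA.spectral_theorem).symm

lemma hermApply_const (c : ℝ) (hA : A.IsHermitian) :
    hermApply (fun _ => c) hA = (c : ℂ) • (1 : Matrix (Fin k) (Fin k) ℂ) := by
  unfold hermApply
  rw [← smul_one_eq_diagonal, Matrix.mul_smul, Matrix.mul_one, Matrix.smul_mul,
    ← Unitary.coe_star, Unitary.coe_mul_star_self]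

lemma hermApply_mul (f g : ℝ → ℝ) (hA : A.IsHermitian) :
    hermApply f hA * hermApply g hA = hermApply (fun x => f x * g x) hA := by
  unfold hermApply
  set U := hA.eigenvectorUnitary
  calc _ = (U : Matrix (Fin k) (Fin k) ℂ) * diagonal (fun i => (f (hA.eigenvalues i) : ℂ)) *
        ((star (U : Matrix (Fin k) (Fin k) ℂ)) * U) *
        diagonal (fun i => (g (hA.eigenvalues i) : ℂ)) *
        (star (U : Matrix (Fin k) (Fin k) ℂ)) := by simp only [Matrix.mul_assoc]
    _ = _ := by
      rw [Unitary.coe_star_mul_self, Matrix.mul_one,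
        Matrix.mul_assoc (U : Matrix (Fin k) (Fin k) ℂ), diagonal_mul_diagonal]
      simp

lemma hermApply_congr {f g : ℝ → ℝ} (hA : A.PosDef) (h : ∀ x, 0 < x → f x = g x) :
    hermApply f hA.1 = hermApply g hA.1 := by
  unfold hermApply
  congr 3
  ext i
  rw [h _ (hA.eigenvalues_pos i)]

lemma hermApply_mul_inv {f : ℝ → ℝ} (hA : A.PosDef) (hf : ∀ x, 0 < x → 0 < f x) :
    hermApply f hA.1 * hermApply (fun x => (f x)⁻¹) hA.1 = 1 := by
  rw [hermApply_mul, hermApply_congr (g := fun _ => 1) hA fun x hx => mul_inv_cancel₀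
    (hf x hx).ne', hermApply_const, Complex.ofReal_one, one_smul]

lemma hermApply_neg (f : ℝ → ℝ) (hA : A.IsHermitian) :
    hermApply (fun x => -f x) hA = -hermApply f hA := by
  unfold hermApply
  simp [← Matrix.diagonal_neg]

lemma dotProduct_hermApply_mulVec (f : ℝ → ℝ) (hA : A.IsHermitian) (x : Fin k → ℂ) :
    star x ⬝ᵥ (hermApply f hA *ᵥ x) =
      ((∑ i, f (hA.eigenvalues i) * Complex.normSq
        ((star (hA.eigenvectorUnitary : Matrix (Fin k) (Fin k) ℂ) *ᵥ x) i) : ℝ) : ℂ) := by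
  unfold hermApply
  set U : Matrix (Fin k) (Fin k) ℂ := (hA.eigenvectorUnitary : Matrix (Fin k) (Fin k) ℂ)
  have h : star x ᵥ* U = star (star U *ᵥ x) := by
    rw [star_mulVec, star_eq_conjTranspose, conjTranspose_conjTranspose]
  rw [← mulVec_mulVec, ← mulVec_mulVec, dotProduct_mulVec, h, dotProduct]
  push_cast
  refine Finset.sum_congr rfl fun i _ => ?_
  rw [mulVec_diagonal, Complex.normSq_eq_conj_mul_self, Pi.star_apply, Complex.star_def]
  ring

lemma posSemidef_hermApply {f : ℝ → ℝ} (hA : A.PosDef) (hf : ∀ x, 0 < x → 0 < f x) :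
    (hermApply f hA.1).PosSemidef := by
  refine .of_dotProduct_mulVec_nonneg (isHermitian_hermApply _ _) fun x => ?_
  rw [dotProduct_hermApply_mulVec, Complex.zero_le_real]
  exact Finset.sum_nonneg fun i _ =>
    mul_nonneg (hf _ (hA.eigenvalues_pos i)).le (Complex.normSq_nonneg _)

open scoped MatrixOrder Matrix.Norms.L2Operator in
lemma Matrix.posSemidef_sub_of_inverse {a b a' b' : Matrix (Fin k) (Fin k) ℂ}
    (ha : a.PosSemidef) (hab : (b - a).PosSemidef) (haa' : a * a' = 1) (hbb' : b * b' = 1) :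
    (a' - b').PosSemidef :=
  CStarAlgebra.inv_le_inv (a := ⟨a, a', haa', mul_eq_one_comm.mp haa'⟩)
    (b := ⟨b, b', hbb', mul_eq_one_comm.mp hbb'⟩) ha.nonneg hab

end HermApply

lemma isOperatorMonotone_iff {f : ℝ → ℝ} : IsOperatorMonotone f ↔
    ∀ (k : ℕ) (A B : Matrix (Fin k) (Fin k) ℂ) (hA : A.PosDef) (hB : B.PosDef),
    (B - A).PosSemidef → ∀ x : Fin k → ℂ,
      0 ≤ ∑ i, f (hB.1.eigenvalues i) * Complex.normSq
        ((star (hB.1.eigenvectorUnitary : Matrix (Fin k) (Fin k) ℂ) *ᵥ x) i) -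
      ∑ i, f (hA.1.eigenvalues i) * Complex.normSq
        ((star (hA.1.eigenvectorUnitary : Matrix (Fin k) (Fin k) ℂ) *ᵥ x) i) := by
  unfold IsOperatorMonotone
  refine forall₅_congr fun k A B hA hB => imp_congr_right fun _ => ?_
  rw [posSemidef_iff_dotProduct_mulVec,
    and_iff_right ((isHermitian_hermApply _ _).sub (isHermitian_hermApply _ _))]
  refine forall_congr' fun x => ?_
  rw [sub_mulVec, dotProduct_sub, dotProduct_hermApply_mulVec, dotProduct_hermApply_mulVec,
    ← Complex.ofReal_sub, Complex.zero_le_real]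

namespace IsOperatorMonotone

variable {f g : ℝ → ℝ}

lemma congr (hf : IsOperatorMonotone f) (h : ∀ x, 0 < x → f x = g x) : IsOperatorMonotone g := by
  intro k A B hA hB hAB
  rw [← hermApply_congr hA h, ← hermApply_congr hB h]
  exact hf k A B hA hB hAB

lemma id : IsOperatorMonotone (fun x => x) := by
  intro k A B hA hB hAB
  rwa [hermApply_id, hermApply_id]

lemma const (c : ℝ) : IsOperatorMonotone (fun _ => c) := by
  intro k A B hA hB _
  rw [hermApply_const, hermApply_const, sub_self]
  exact .zero

lemma add (hf : IsOperatorMonotone f) (hg : IsOperatorMonotone g) :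
    IsOperatorMonotone (fun x => f x + g x) := by
  rw [isOperatorMonotone_iff] at *
  intro k A B hA hB hAB x
  have h₁ := hf k A B hA hB hAB x
  have h₂ := hg k A B hA hB hAB x
  simp only [add_mul, Finset.sum_add_distrib]
  linarith

lemma const_mul (hf : IsOperatorMonotone f) {c : ℝ} (hc : 0 ≤ c) :
    IsOperatorMonotone (fun x => c * f x) := by
  rw [isOperatorMonotone_iff] at *
  intro k A B hA hB hAB x
  simp only [mul_assoc, ← Finset.mul_sum, ← mul_sub]
  exact mul_nonneg hc (hf k A B hA hB hAB x)

lemma of_tendsto {F : ℕ → ℝ → ℝ} (hF : ∀ n, IsOperatorMonotone (F n))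
    (h : ∀ x, 0 < x → Tendsto (fun n => F n x) atTop (𝓝 (f x))) : IsOperatorMonotone f := by
  simp only [isOperatorMonotone_iff] at *
  intro k A B hA hB hAB x
  exact ge_of_tendsto'
    ((tendsto_finsetSum _ fun i _ => (h _ (hB.eigenvalues_pos i)).mul_const _).sub
      (tendsto_finsetSum _ fun i _ => (h _ (hA.eigenvalues_pos i)).mul_const _))
    fun n => hF n k A B hA hB hAB x

lemma integral {μ : Measure ℝ} {F : ℝ → ℝ → ℝ} (hF : ∀ᵐ t ∂μ, IsOperatorMonotone (F t))
    (hi : ∀ x, 0 < x → Integrable (fun t => F t x) μ) :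
    IsOperatorMonotone (fun x => ∫ t, F t x ∂μ) := by
  simp only [isOperatorMonotone_iff] at *
  intro k A B hA hB hAB x
  have hiA := fun i (_ : i ∈ Finset.univ) => (hi _ (hA.eigenvalues_pos i)).mul_const
    (Complex.normSq ((star (hA.1.eigenvectorUnitary : Matrix (Fin k) (Fin k) ℂ) *ᵥ x) i))
  have hiB := fun i (_ : i ∈ Finset.univ) => (hi _ (hB.eigenvalues_pos i)).mul_const
    (Complex.normSq ((star (hB.1.eigenvectorUnitary : Matrix (Fin k) (Fin k) ℂ) *ᵥ x) i))
  simp only [← integral_mul_const]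
  rw [← integral_finsetSum _ hiA, ← integral_finsetSum _ hiB,
    ← integral_sub (integrable_finsetSum _ hiB) (integrable_finsetSum _ hiA)]
  refine integral_nonneg_of_ae ?_
  filter_upwards [hF] with t ht using ht k A B hA hB hAB x

lemma neg_inv (hf : IsOperatorMonotone f) (hpos : ∀ x, 0 < x → 0 < f x) :
    IsOperatorMonotone (fun x => -(f x)⁻¹) := by
  intro k A B hA hB hAB
  rw [hermApply_neg, hermApply_neg, neg_sub_neg]
  exact posSemidef_sub_of_inverse (posSemidef_hermApply hA hpos) (hf k A B hA hB hAB)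
    (hermApply_mul_inv hA hpos) (hermApply_mul_inv hB hpos)

lemma inv_of_neg (hf : IsOperatorMonotone (fun x => -f x)) (hpos : ∀ x, 0 < x → 0 < f x) :
    IsOperatorMonotone (fun x => (f x)⁻¹) := by
  intro k A B hA hB hAB
  have h := hf k A B hA hB hAB
  rw [hermApply_neg, hermApply_neg, neg_sub_neg] at h
  exact posSemidef_sub_of_inverse (posSemidef_hermApply hB hpos) h (hermApply_mul_inv hB hpos)
    (hermApply_mul_inv hA hpos)

/-- Weighted geometric means of positive operator decreasing functions are operator decreasing. -/
lemma neg_rpow_mul_rpow (hf : IsOperatorMonotone (fun x => -f x))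
    (hg : IsOperatorMonotone (fun x => -g x)) (hf₀ : ∀ x, 0 < x → 0 < f x)
    (hg₀ : ∀ x, 0 < x → 0 < g x) {p : ℝ} (hp : p ∈ Ioo (0 : ℝ) 1) :
    IsOperatorMonotone (fun x => -(f x ^ p * g x ^ (1 - p))) := by
  obtain ⟨μ, hμ⟩ := Real.exists_measure_rpow_eq_integral_rpowIntegrand₀₁ hp
  have hmono : ∀ t ∈ Ioi (0 : ℝ), IsOperatorMonotone
      (fun x => -(Real.rpowIntegrand₀₁ p t (f x / g x) * g x)) := by
    intro t (ht : 0 < t)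
    have h := (((hf.inv_of_neg hf₀).const_mul ht.le).add (hg.inv_of_neg hg₀)).neg_inv
      fun x hx => by have := hf₀ x hx; have := hg₀ x hx; positivity
    refine (h.const_mul (Real.rpow_nonneg ht.le (p - 1))).congr fun x hx => ?_
    have h₁ := hf₀ x hx
    have h₂ := hg₀ x hx
    rw [Real.rpowIntegrand₀₁_eq_pow_div hp ht.le (by positivity)]
    field_simp
  have hint : ∀ x, 0 < x → IntegrableOn
      (fun t => -(Real.rpowIntegrand₀₁ p t (f x / g x) * g x)) (Ioi 0) μ := fun x hx =>
    ((hμ _ (div_pos (hf₀ x hx) (hg₀ x hx)).le).1.mul_const _).neg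
  refine (integral (ae_restrict_of_forall_mem measurableSet_Ioi hmono) hint).congr fun x hx => ?_
  have h₁ := hf₀ x hx
  have h₂ := hg₀ x hx
  rw [MeasureTheory.integral_neg, integral_mul_const, ← (hμ _ (div_pos h₁ h₂).le).2,
    Real.div_rpow h₁.le h₂.le, Real.rpow_sub h₂, Real.rpow_one]
  ring

end IsOperatorMonotone

/-- The difference quotient `(x ^ α - 1) / (x - 1)`, extended continuously to `x = 1`. -/
noncomputable def rpowSlope (α x : ℝ) : ℝ := if x = 1 then α else (x ^ α - 1) / (x - 1)

lemma rpowSlope_pos {α x : ℝ} (hα : 0 < α) (hx : 0 < x) : 0 < rpowSlope α x := by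
  unfold rpowSlope
  split_ifs with h
  · exact hα
  rcases lt_or_gt_of_ne h with h | h
  · exact div_pos_of_neg_of_neg (by linarith [Real.rpow_lt_one hx.le h hα]) (by linarith)
  · exact div_pos (by linarith [Real.one_lt_rpow h hα]) (by linarith)

lemma segment_pos {t x : ℝ} (ht : t ∈ Icc (0 : ℝ) 1) (hx : 0 < x) : 0 < 1 - t + t * x := by
  rcases ht.1.eq_or_lt with h | h
  · simp [← h]
  · nlinarith [ht.2, mul_pos h hx]

lemma continuousOn_segment_rpow {x : ℝ} (hx : 0 < x) (p : ℝ) :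
    ContinuousOn (fun t : ℝ => (1 - t + t * x) ^ p) (Icc 0 1) :=
  ContinuousOn.rpow_const (by fun_prop) fun _ ht => Or.inl (segment_pos ht hx).ne'

lemma rpowSlope_eq_integral {α x : ℝ} (hx : 0 < x) :
    rpowSlope α x = ∫ t in Icc (0 : ℝ) 1, α * (1 - t + t * x) ^ (α - 1) := by
  rw [integral_Icc_eq_integral_Ioc, ← intervalIntegral.integral_of_le zero_le_one]
  unfold rpowSlope
  split_ifs with h
  · simp [h]
  have hx1 : x - 1 ≠ 0 := sub_ne_zero.mpr h
  have hderiv : ∀ t ∈ uIcc (0 : ℝ) 1, HasDerivAt (fun t : ℝ => (1 - t + t * x) ^ α / (x - 1))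
      (α * (1 - t + t * x) ^ (α - 1)) t := by
    intro t ht
    rw [uIcc_of_le zero_le_one] at ht
    have h₁ : HasDerivAt (fun t : ℝ => 1 - t + t * x) (x - 1) t := by
      exact (((hasDerivAt_id t).const_sub 1).add ((hasDerivAt_id t).mul_const x)).congr_deriv
        (by ring)
    exact ((h₁.rpow_const (p := α) (Or.inl (segment_pos ht hx).ne')).div_const (x - 1)).congr_deriv
      (by field_simp)
  rw [intervalIntegral.integral_eq_sub_of_hasDerivAt hderiv]
  · simp only [sub_self, zero_add, one_mul, sub_zero, zero_mul, add_zero, Real.one_rpow]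
    ring
  · refine ContinuousOn.intervalIntegrable ?_
    rw [uIcc_of_le zero_le_one]
    exact continuousOn_const.mul (continuousOn_segment_rpow hx _)

/-- Multiplication of the `α`-th power by `rpowSlope α` preserves positive operator decreasing
functions. Its unique positive fixed point is `1 / gAlpha α`. -/
lemma IsOperatorMonotone.neg_rpowSlope_mul_rpow {α : ℝ} (hα : α ∈ Ioo (0 : ℝ) 1) {f : ℝ → ℝ}
    (hf : IsOperatorMonotone (fun x => -f x)) (hf₀ : ∀ x, 0 < x → 0 < f x) :
    IsOperatorMonotone (fun x => -(rpowSlope α x * f x ^ α)) := by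
  have hmono : ∀ t ∈ Icc (0 : ℝ) 1, IsOperatorMonotone
      (fun x => -(α * (1 - t + t * x) ^ (α - 1) * f x ^ α)) := by
    intro t ht
    have hw := ((const (1 - t)).add (id.const_mul ht.1)).neg_inv fun x hx => segment_pos ht hx
    refine ((hf.neg_rpow_mul_rpow hw hf₀ (fun x hx => inv_pos.mpr (segment_pos ht hx))
      hα).const_mul hα.1.le).congr fun x hx => ?_
    rw [Real.inv_rpow (segment_pos ht hx).le, ← Real.rpow_neg (segment_pos ht hx).le, neg_sub]
    ring
  have hint : ∀ x, 0 < x → IntegrableOn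
      (fun t => -(α * (1 - t + t * x) ^ (α - 1) * f x ^ α)) (Icc 0 1) := fun x hx =>
    (((continuousOn_const.mul (continuousOn_segment_rpow hx _)).mul
      continuousOn_const).neg).integrableOn_compact isCompact_Icc
  refine (integral (ae_restrict_of_forall_mem measurableSet_Icc hmono) hint).congr fun x hx => ?_
  rw [MeasureTheory.integral_neg, integral_mul_const, rpowSlope_eq_integral hx]

lemma IsOperatorMonotone.neg_rpowSlope_rpow_geom_sum {α : ℝ} (hα : α ∈ Ioo (0 : ℝ) 1) (n : ℕ) :
    IsOperatorMonotone (fun x => -rpowSlope α x ^ (∑ i ∈ Finset.range n, α ^ i)) := by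
  induction n with
  | zero => simpa using const (-1)
  | succ n ih =>
    refine (ih.neg_rpowSlope_mul_rpow hα fun x hx =>
      Real.rpow_pos_of_pos (rpowSlope_pos hα.1 hx) _).congr fun x hx => ?_
    have h := rpowSlope_pos hα.1 hx
    rw [← Real.rpow_mul h.le, geom_sum_succ, Real.rpow_add h, Real.rpow_one, mul_comm α,
      mul_comm (rpowSlope α x)]

lemma gAlpha_eq_inv_rpowSlope_rpow {α x : ℝ} (hα : 0 < α) (hx : 0 < x) :
    gAlpha α x = (rpowSlope α x ^ (1 - α)⁻¹)⁻¹ := by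
  rw [← Real.rpow_neg (rpowSlope_pos hα hx).le, ← _root_.inv_neg, neg_sub]
  unfold gAlpha rpowSlope
  split_ifs <;> simp

/-- For `0 < α < 1`, the function `g_α` is operator monotone: for every dimension `k` and
positive definite Hermitian matrices `A ≤ B` (Loewner order), `g_α(A) ≤ g_α(B)` in the
Loewner order, where `g_α` is applied via the functional calculus. -/
theorem gAlpha_operator_monotone (α : ℝ) (hα0 : 0 < α) (hα1 : α < 1) :
    ∀ (k : ℕ) (A B : Matrix (Fin k) (Fin k) ℂ) (hA : A.PosDef) (hB : B.PosDef),
      (B - A).PosSemidef →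
      (hermApply (gAlpha α) hB.1 - hermApply (gAlpha α) hA.1).PosSemidef := by
  intro k A B hA hB hAB
  have hlim : IsOperatorMonotone (fun x => -rpowSlope α x ^ (1 - α)⁻¹) :=
    .of_tendsto (IsOperatorMonotone.neg_rpowSlope_rpow_geom_sum ⟨hα0, hα1⟩) fun x hx =>
      (tendsto_const_nhds.rpow (hasSum_geometric_of_lt_one hα0.le hα1).tendsto_sum_nat
        (Or.inl (rpowSlope_pos hα0 hx).ne')).neg
  exact ((hlim.inv_of_neg fun x hx => Real.rpow_pos_of_pos (rpowSlope_pos hα0 hx) _).congr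
    fun x hx => (gAlpha_eq_inv_rpowSlope_rpow hα0 hx).symm) k A B hA hB hAB
end

section
/- Define h : (0, ∞) → (0, ∞) by h(x) := (x − 1)/log x for x ≠ 1 and h(1) := 1. Then h(x) = ∫₀¹ x^t dt for all x > 0, and h is operator monotone: for every n and all positive definite n × n Hermitian matrices A ≤ B in the Loewner order, h(A) ≤ h(B) via the functional calculus. -/
open scoped ComplexOrder

/-- `h(x) = (x − 1)/log x` for `x ≠ 1`, and `h(1) = 1`. -/
noncomputable def hFun (x : ℝ) : ℝ :=
  if x = 1 then 1 else (x - 1) / Real.log x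

theorem hFun_eq_integral_rpow {x : ℝ} (hx : 0 < x) :
    hFun x = ∫ t in (0 : ℝ)..1, x ^ t := by
  rcases eq_or_ne x 1 with rfl | hx1
  · simp [hFun]
  have hlog : Real.log x ≠ 0 := Real.log_ne_zero_of_pos_of_ne_one hx hx1
  have hderiv : ∀ t ∈ Set.uIcc (0 : ℝ) 1,
      HasDerivAt (fun t : ℝ => x ^ t / Real.log x) (x ^ t) t := fun t _ => by
    simpa [hlog] using ((hasDerivAt_id t).const_rpow hx).div_const (Real.log x)
  rw [intervalIntegral.integral_eq_sub_of_hasDerivAt hderiv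
    (Real.continuous_const_rpow hx.ne').continuousOn.intervalIntegrable]
  simp [hFun, hx1, sub_div]

/-- On `[0, 1]` the powers of a positive number are bounded uniformly in the exponent. -/
theorem rpow_le_one_add {x t : ℝ} (hx : 0 < x) (ht : t ∈ Set.Ioc (0 : ℝ) 1) :
    x ^ t ≤ 1 + x := by
  rcases le_total x 1 with h | h
  · linarith [Real.rpow_le_one hx.le h ht.1.le]
  · linarith [Real.rpow_le_self_of_one_le h ht.2]

section CStarAlgebra

open MeasureTheory

variable {A : Type*} [CStarAlgebra A] [PartialOrder A] [StarOrderedRing A]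

theorem continuousOn_rpow_spectrum {a : A} (ha : IsStrictlyPositive a) :
    ContinuousOn (Function.uncurry fun t x : ℝ => x ^ t)
      (Set.Ioc (0 : ℝ) 1 ×ˢ spectrum ℝ a) := by
  refine continuousOn_snd.rpow continuousOn_fst fun p hp => Or.inl ?_
  exact (ha.spectrum_pos hp.2).ne'

theorem norm_rpow_le_on_spectrum {a : A} (ha : IsStrictlyPositive a) :
    ∀ᵐ t ∂(volume.restrict (Set.Ioc (0 : ℝ) 1)), ∀ x ∈ spectrum ℝ a,
      ‖x ^ t‖ ≤ 1 + ‖a‖ * ‖(1 : A)‖ := by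
  refine ae_restrict_of_forall_mem measurableSet_Ioc fun t ht x hx => ?_
  have hx0 : 0 < x := ha.spectrum_pos hx
  have hxa : ‖x‖ ≤ ‖a‖ * ‖(1 : A)‖ := spectrum.norm_le_norm_mul_of_mem hx
  rw [Real.norm_of_nonneg (Real.rpow_nonneg hx0.le t)]
  linarith [rpow_le_one_add hx0 ht, Real.le_norm_self x]

theorem integrableOn_cfc_rpow {a : A} (ha : IsStrictlyPositive a) :
    IntegrableOn (fun t : ℝ => cfc (fun x : ℝ => x ^ t) a) (Set.Ioc (0 : ℝ) 1) :=
  integrableOn_cfc measurableSet_Ioc _ _ a (continuousOn_rpow_spectrum ha)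
    (norm_rpow_le_on_spectrum ha) (by exact hasFiniteIntegral_const _) ha.isSelfAdjoint

theorem cfc_hFun_eq_integral {a : A} (ha : IsStrictlyPositive a) :
    cfc hFun a = ∫ t in Set.Ioc (0 : ℝ) 1, cfc (fun x : ℝ => x ^ t) a := by
  rw [← cfc_setIntegral measurableSet_Ioc _ _ a (continuousOn_rpow_spectrum ha)
    (norm_rpow_le_on_spectrum ha) (by exact hasFiniteIntegral_const _) ha.isSelfAdjoint]
  refine cfc_congr fun x hx => ?_
  rw [hFun_eq_integral_rpow (ha.spectrum_pos hx),
    intervalIntegral.integral_of_le zero_le_one]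

/-- `hFun` is operator monotone on the strictly positive elements of a C⋆-algebra. -/
theorem cfc_hFun_le_cfc_hFun {a b : A} (ha : IsStrictlyPositive a) (hab : a ≤ b) :
    cfc hFun a ≤ cfc hFun b := by
  have hb : IsStrictlyPositive b := ha.of_le hab
  rw [cfc_hFun_eq_integral ha, cfc_hFun_eq_integral hb]
  refine setIntegral_mono_on (integrableOn_cfc_rpow ha) (integrableOn_cfc_rpow hb)
    measurableSet_Ioc fun t ht => ?_
  rw [← CFC.rpow_eq_cfc_real ha.nonneg, ← CFC.rpow_eq_cfc_real hb.nonneg]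
  exact CFC.rpow_le_rpow (Set.Ioc_subset_Icc_self ht) hab

end CStarAlgebra

theorem hermApply_eq_cfc (f : ℝ → ℝ) {k : ℕ} {A : Matrix (Fin k) (Fin k) ℂ}
    (hA : A.IsHermitian) : hermApply f hA = cfc f A := by
  rw [hA.cfc_eq, Matrix.IsHermitian.cfc, Unitary.conjStarAlgAut_apply]
  rfl

open scoped MatrixOrder Matrix.Norms.L2Operator in
theorem hermApply_hFun_mono {k : ℕ} {A B : Matrix (Fin k) (Fin k) ℂ} (hA : A.PosDef)
    (hB : B.PosDef) (hAB : (B - A).PosSemidef) :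
    (hermApply hFun hB.1 - hermApply hFun hA.1).PosSemidef := by
  rw [hermApply_eq_cfc, hermApply_eq_cfc, ← Matrix.le_iff]
  exact cfc_hFun_le_cfc_hFun hA.isStrictlyPositive hAB

/-- `h(x) = ∫₀¹ x^t dt` for all `x > 0`, and `h` is operator monotone: for every
dimension `k` and positive definite Hermitian matrices `A ≤ B` (Loewner order),
`h(A) ≤ h(B)` via the functional calculus. -/
theorem hFun_integral_and_operator_monotone :
    (∀ x : ℝ, 0 < x → hFun x = ∫ t in (0 : ℝ)..1, x ^ t) ∧
    (∀ (k : ℕ) (A B : Matrix (Fin k) (Fin k) ℂ) (hA : A.PosDef) (hB : B.PosDef),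
      (B - A).PosSemidef →
      (hermApply hFun hB.1 - hermApply hFun hA.1).PosSemidef) :=
  ⟨fun _ hx => hFun_eq_integral_rpow hx, fun _ _ _ hA hB hAB => hermApply_hFun_mono hA hB hAB⟩
end
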